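/- arXiv:2212.00424 — 3 statements merged into one kernel-verified Lean document; each statement's English description precedes it below -/
import Mathlib

section
/- The symmetric discordance index satisfies the triangle inequality: for survival data D with |D_ev| ≥ 2 and |D_ce| ≥ 1, and risk functions r₁, r₂, r₃ : ℝ^d → ℝ that are each injective on the set of covariate vectors of instances in D_ev (so each induces a tie-free ranking of D_ev), one has SDI(r₁, r₃; D) ≤ SDI(r₁, r₂; D) + SDI(r₂, r₃; D). -/
open Finset
open scoped Classical

/-- A survival instance: covariate vector, observation time, and event indicator
(`true` = event observed / non-censored, `false` = censored). -/
structure SurvInstance (d : ℕ) where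
  x : Fin d → ℝ
  t : ℝ
  δ : Bool

/-- The non-censored instances of a survival data set. -/
noncomputable def Dev {d : ℕ} (D : Finset (SurvInstance d)) : Finset (SurvInstance d) :=
  D.filter (fun i => i.δ = true)

/-- The censored instances of a survival data set. -/
noncomputable def Dce {d : ℕ} (D : Finset (SurvInstance d)) : Finset (SurvInstance d) :=
  D.filter (fun i => i.δ = false)

/-- Two risk functions rank the covariates of the instances `i`, `j` strictly oppositely. -/
def Discordant {d : ℕ} (r₁ r₂ : (Fin d → ℝ) → ℝ) (i j : SurvInstance d) : Prop :=
  (r₁ i.x < r₁ j.x ∧ r₂ j.x < r₂ i.x) ∨ (r₁ j.x < r₁ i.x ∧ r₂ i.x < r₂ j.x)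

/-- Kendall part of the SDI: the fraction of pairs of distinct non-censored instances that the
two risk functions rank strictly oppositely (counted over ordered pairs, which gives the same
ratio as over unordered pairs since discordance is symmetric). -/
noncomputable def kendallK {d : ℕ} (r₁ r₂ : (Fin d → ℝ) → ℝ)
    (D : Finset (SurvInstance d)) : ℝ :=
  (((Dev D).offDiag.filter (fun p => Discordant r₁ r₂ p.1 p.2)).card : ℝ) /
    (((Dev D).offDiag.card : ℝ))

/-- Risk set: the non-censored instances that `r` ranks strictly above the covariate vector `x`. -/
noncomputable def riskSet {d : ℕ} (r : (Fin d → ℝ) → ℝ) (D : Finset (SurvInstance d))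
    (x : Fin d → ℝ) : Finset (SurvInstance d) :=
  (Dev D).filter (fun j => r x < r j.x)

/-- Jaccard distance between finite sets, with the convention `0` when the union is empty. -/
noncomputable def jaccardDist {α : Type*} (A B : Finset α) : ℝ :=
  ((symmDiff A B).card : ℝ) / ((A ∪ B).card : ℝ)

/-- Jaccard part of the SDI: the average over censored instances of the Jaccard distance between
the risk sets induced by the two risk functions. -/
noncomputable def jaccardJ {d : ℕ} (r₁ r₂ : (Fin d → ℝ) → ℝ)
    (D : Finset (SurvInstance d)) : ℝ :=
  (∑ i ∈ Dce D, jaccardDist (riskSet r₁ D i.x) (riskSet r₂ D i.x)) / ((Dce D).card : ℝ)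

/-- The weight `α₁ = |D_ev| (|D_ev| - 1) / 2`. -/
noncomputable def alpha1 {d : ℕ} (D : Finset (SurvInstance d)) : ℝ :=
  ((Dev D).card : ℝ) * (((Dev D).card : ℝ) - 1) / 2

/-- The weight `α₂ = |D_ev| ⬝ |D_ce| / 2`. -/
noncomputable def alpha2 {d : ℕ} (D : Finset (SurvInstance d)) : ℝ :=
  ((Dev D).card : ℝ) * ((Dce D).card : ℝ) / 2

/-- The symmetric discordance index. -/
noncomputable def SDI {d : ℕ} (r₁ r₂ : (Fin d → ℝ) → ℝ) (D : Finset (SurvInstance d)) : ℝ :=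
  (alpha1 D / (alpha1 D + alpha2 D)) * kendallK r₁ r₂ D +
    (alpha2 D / (alpha1 D + alpha2 D)) * jaccardJ r₁ r₂ D

lemma jaccardDist_triangle {α : Type*} (A B C : Finset α) :
    jaccardDist A C ≤ jaccardDist A B + jaccardDist B C := by
  unfold jaccardDist
  set u : ℕ := (A ∪ B ∪ C).card with hu
  set b : ℕ := (B \ (A ∪ C)).card with hb
  have hub : u = (A ∪ C).card + b := by
    rw [hu, hb, ← Finset.card_union_of_disjoint Finset.disjoint_sdiff]
    congr 1
    ext x
    simp only [Finset.mem_union, Finset.mem_sdiff]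
    tauto
  have hp : (symmDiff A C).card ≤ (A ∪ C).card := by
    apply Finset.card_le_card
    intro x
    simp only [Finset.mem_union, Finset.mem_symmDiff]
    tauto
  have hAB : (A ∪ B).card ≤ u := Finset.card_le_card (by
    intro x
    simp only [Finset.mem_union]
    tauto)
  have hBC : (B ∪ C).card ≤ u := Finset.card_le_card (by
    intro x
    simp only [Finset.mem_union]
    tauto)
  have hmain : (symmDiff A C).card + b ≤ (symmDiff A B).card + (symmDiff B C).card := by
    rw [hb, ← Finset.card_union_add_card_inter (symmDiff A B),
      ← Finset.card_union_of_disjoint]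
    · refine le_trans (Finset.card_le_card ?_) (Nat.le_add_right _ _)
      intro x
      simp only [Finset.mem_union, Finset.mem_symmDiff, Finset.mem_sdiff]
      tauto
    · rw [Finset.disjoint_left]
      intro x
      simp only [Finset.mem_union, Finset.mem_symmDiff, Finset.mem_sdiff]
      tauto
  have key : ∀ S T : Finset α, (S ∪ T).card ≤ u →
      ((symmDiff S T).card : ℝ) / u ≤ ((symmDiff S T).card : ℝ) / ((S ∪ T).card : ℝ) := by
    intro S T h
    rcases Nat.eq_zero_or_pos (S ∪ T).card with h0 | h0
    · have : (symmDiff S T).card = 0 := by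
        rw [← Nat.le_zero, ← h0]
        apply Finset.card_le_card
        intro x
        simp only [Finset.mem_union, Finset.mem_symmDiff]
        tauto
      simp [this]
    · have h0' : (0 : ℝ) < ((S ∪ T).card : ℝ) := by exact_mod_cast h0
      have h' : ((S ∪ T).card : ℝ) ≤ u := by exact_mod_cast h
      exact div_le_div_of_nonneg_left (Nat.cast_nonneg _) h0' h'
  refine le_trans ?_ (add_le_add (key A B hAB) (key B C hBC))
  rw [← add_div]
  rcases Nat.eq_zero_or_pos (A ∪ C).card with h0 | h0
  · rw [h0]
    simp only [Nat.cast_zero, div_zero]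
    positivity
  · have hq : (0 : ℝ) < ((A ∪ C).card : ℝ) := by exact_mod_cast h0
    have hu' : (u : ℝ) = ((A ∪ C).card : ℝ) + b := by exact_mod_cast hub
    have hp' : ((symmDiff A C).card : ℝ) ≤ ((A ∪ C).card : ℝ) := by exact_mod_cast hp
    have hm' : ((symmDiff A C).card : ℝ) + b ≤
        ((symmDiff A B).card : ℝ) + ((symmDiff B C).card : ℝ) := by exact_mod_cast hmain
    have hb0 : (0 : ℝ) ≤ b := Nat.cast_nonneg _
    have hupos : (0 : ℝ) < u := by linarith
    rw [div_le_div_iff₀ hq hupos, hu']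
    nlinarith [mul_le_mul_of_nonneg_right hp' hb0, mul_le_mul_of_nonneg_right hm' hq.le]

lemma kendallK_triangle {d : ℕ} (D : Finset (SurvInstance d))
    (hinj : Set.InjOn (fun i : SurvInstance d => i.x) ↑D)
    (r₁ r₂ r₃ : (Fin d → ℝ) → ℝ)
    (h₂ : Set.InjOn r₂ ↑((Dev D).image (fun i => i.x))) :
    kendallK r₁ r₃ D ≤ kendallK r₁ r₂ D + kendallK r₂ r₃ D := by
  unfold kendallK
  rw [← add_div]
  apply div_le_div_of_nonneg_right _ (Nat.cast_nonneg _)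
  have : ((Dev D).offDiag.filter (fun p => Discordant r₁ r₃ p.1 p.2)).card ≤
      ((Dev D).offDiag.filter (fun p => Discordant r₁ r₂ p.1 p.2)).card +
      ((Dev D).offDiag.filter (fun p => Discordant r₂ r₃ p.1 p.2)).card := by
    refine le_trans (Finset.card_le_card ?_) (Finset.card_union_le _ _)
    rintro ⟨i, j⟩ h
    simp only [Finset.mem_union, Finset.mem_filter, Finset.mem_offDiag] at h ⊢
    obtain ⟨⟨hi, hj, hij⟩, hd⟩ := h
    have hne : r₂ i.x ≠ r₂ j.x := by
      intro he
      have hx : i.x = j.x := h₂ (by simpa using ⟨i, hi, rfl⟩) (by simpa using ⟨j, hj, rfl⟩) he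
      exact hij (hinj (Finset.mem_coe.2 (Finset.mem_filter.1 hi).1)
        (Finset.mem_coe.2 (Finset.mem_filter.1 hj).1) hx)
    unfold Discordant at hd ⊢
    rcases lt_or_gt_of_ne hne with h | h <;> tauto
  exact_mod_cast this

lemma jaccardJ_triangle {d : ℕ} (D : Finset (SurvInstance d)) (r₁ r₂ r₃ : (Fin d → ℝ) → ℝ) :
    jaccardJ r₁ r₃ D ≤ jaccardJ r₁ r₂ D + jaccardJ r₂ r₃ D := by
  unfold jaccardJ
  rw [← add_div, ← Finset.sum_add_distrib]
  exact div_le_div_of_nonneg_right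
    (Finset.sum_le_sum fun i _ => jaccardDist_triangle _ _ _) (Nat.cast_nonneg _)

/-- The symmetric discordance index satisfies the triangle inequality,
for risk functions that are injective on the covariate vectors of the non-censored
instances (tie-free rankings). -/
theorem SDI_triangle {d : ℕ} (D : Finset (SurvInstance d))
    (hinj : Set.InjOn (fun i : SurvInstance d => i.x) ↑D)
    (hev : 2 ≤ (Dev D).card) (hce : 1 ≤ (Dce D).card)
    (r₁ r₂ r₃ : (Fin d → ℝ) → ℝ)
    (h₁ : Set.InjOn r₁ ↑((Dev D).image (fun i => i.x)))
    (h₂ : Set.InjOn r₂ ↑((Dev D).image (fun i => i.x)))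
    (h₃ : Set.InjOn r₃ ↑((Dev D).image (fun i => i.x))) :
    SDI r₁ r₃ D ≤ SDI r₁ r₂ D + SDI r₂ r₃ D := by
  have hK := kendallK_triangle D hinj r₁ r₂ r₃ h₂
  have hJ := jaccardJ_triangle D r₁ r₂ r₃
  have hev' : (2 : ℝ) ≤ ((Dev D).card : ℝ) := by exact_mod_cast hev
  have ha1 : 0 ≤ alpha1 D := by
    unfold alpha1
    have : (0 : ℝ) ≤ ((Dev D).card : ℝ) - 1 := by linarith
    positivity
  have ha2 : 0 ≤ alpha2 D := by
    unfold alpha2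
    positivity
  have e1 := mul_le_mul_of_nonneg_left hK (div_nonneg ha1 (add_nonneg ha1 ha2))
  have e2 := mul_le_mul_of_nonneg_left hJ (div_nonneg ha2 (add_nonneg ha1 ha2))
  unfold SDI
  linarith
end

section
/- The discordant-pair count of Kendall tau satisfies the triangle inequality through any tie-free middle ranking: let S be a finite set and f₁, f₂, f₃ : S → ℝ with f₂ injective. Then K_d(f₁, f₃) ≤ K_d(f₁, f₂) + K_d(f₂, f₃). -/
open Finset
open scoped Classical

/-- The number of unordered pairs of distinct elements of `S` on which `g` and `h` disagree
strictly (realized as half the number of such ordered pairs). -/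
noncomputable def discCount {ι : Type*} (S : Finset ι) (g h : ι → ℝ) : ℝ :=
  ((S.offDiag.filter (fun p =>
      (g p.1 < g p.2 ∧ h p.2 < h p.1) ∨ (g p.2 < g p.1 ∧ h p.1 < h p.2))).card : ℝ) / 2

/-- The discordant-pair count of Kendall tau satisfies the triangle
inequality through any tie-free (injective) middle ranking. -/
theorem discCount_triangle {ι : Type*} (S : Finset ι) (f₁ f₂ f₃ : ι → ℝ)
    (hinj : Set.InjOn f₂ ↑S) :
    discCount S f₁ f₃ ≤ discCount S f₁ f₂ + discCount S f₂ f₃ := by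
  unfold discCount
  rw [← add_div]
  apply div_le_div_of_nonneg_right _ (by norm_num : (0 : ℝ) ≤ 2)
  norm_cast
  refine le_trans (Finset.card_le_card ?_) (Finset.card_union_le _ _)
  rintro ⟨a, b⟩ h
  simp only [Finset.mem_union, Finset.mem_filter, Finset.mem_offDiag] at h ⊢
  obtain ⟨⟨ha, hb, hab⟩, h⟩ := h
  have hne : f₂ a ≠ f₂ b := fun e => hab (hinj ha hb e)
  rcases lt_or_gt_of_ne hne with h2 | h2 <;> rcases h with ⟨h1, h3⟩ | ⟨h1, h3⟩ <;> simp [*]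
end

section
/- Generalization bound for the target survival domain (fixed-sample form of Theorem 2): let X be a type, d_t : X → X → ℝ and d₁, …, d_K : X → X → ℝ functions each satisfying symmetry and the triangle inequality and taking values in the interval [0, 1], let w₁, …, w_K be nonnegative reals with w₁ + ⋯ + w_K = 1, let H ⊆ X be a nonempty set (the hypothesis space), and let f_t, f_{s_1}, …, f_{s_K} ∈ X. Define the discordance-based distance disc_i = sup_{g, g' ∈ H} |d_i(g, g') − d_t(g, g')| and the minimal joint loss η = inf_{g ∈ H} ( d_t(g, f_t) + Σ_{i=1}^K w_i·d_i(g, f_{s_i}) ). Then for every h ∈ H: d_t(h, f_t) ≤ η + Σ_{i=1}^K w_i·( d_i(h, f_{s_i}) + disc_i ). -/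
/-- Generalization bound for the target survival domain (fixed-sample form
of Theorem 2): the target loss of any hypothesis `h` in the hypothesis space `H` is bounded by
the minimal joint loss `η` plus the weighted sum of the source losses of `h` and the
discordance-based discrepancies between each source and the target. -/
theorem target_generalization_bound {X : Type*} (K : ℕ)
    (dt : X → X → ℝ) (ds : Fin K → X → X → ℝ)
    (hts : ∀ x y : X, dt x y = dt y x)
    (htt : ∀ x y z : X, dt x z ≤ dt x y + dt y z)
    (htb : ∀ x y : X, dt x y ∈ Set.Icc (0 : ℝ) 1)
    (hss : ∀ (i : Fin K) (x y : X), ds i x y = ds i y x)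
    (hst : ∀ (i : Fin K) (x y z : X), ds i x z ≤ ds i x y + ds i y z)
    (hsb : ∀ (i : Fin K) (x y : X), ds i x y ∈ Set.Icc (0 : ℝ) 1)
    (w : Fin K → ℝ) (hw : ∀ i, 0 ≤ w i) (hwsum : ∑ i, w i = 1)
    (H : Set X) (hH : H.Nonempty)
    (ft : X) (fs : Fin K → X)
    (disc : Fin K → ℝ)
    (hdisc : ∀ i, disc i = sSup {v : ℝ | ∃ g ∈ H, ∃ g' ∈ H, v = |ds i g g' - dt g g'|})
    (η : ℝ)
    (hη : η = sInf {v : ℝ | ∃ g ∈ H, v = dt g ft + ∑ i, w i * ds i g (fs i)})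
    (h : X) (hh : h ∈ H) :
    dt h ft ≤ η + ∑ i, w i * (ds i h (fs i) + disc i) := by
  have hd : ∀ i, ∀ g ∈ H, ∀ g' ∈ H, |ds i g g' - dt g g'| ≤ disc i := by
    intro i g hg g' hg'
    rw [hdisc i]
    refine le_csSup ⟨1, ?_⟩ ⟨g, hg, g', hg', rfl⟩
    rintro v ⟨a, _, b, _, rfl⟩
    obtain ⟨h1, h2⟩ := hsb i a b
    obtain ⟨h3, h4⟩ := htb a b
    rw [abs_le]
    constructor <;> linarith
  have key : dt h ft - ∑ i, w i * (ds i h (fs i) + disc i) ≤ η := by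
    rw [hη]
    obtain ⟨g0, hg0⟩ := hH
    refine le_csInf ⟨_, g0, hg0, rfl⟩ ?_
    rintro v ⟨g, hg, rfl⟩
    have h1 : dt h g ≤ ∑ i, w i * (ds i h (fs i) + disc i) + ∑ i, w i * ds i g (fs i) := by
      calc dt h g = ∑ i, w i * dt h g := by rw [← Finset.sum_mul, hwsum, one_mul]
        _ ≤ ∑ i, (w i * (ds i h (fs i) + disc i) + w i * ds i g (fs i)) := by
          refine Finset.sum_le_sum fun i _ => ?_
          rw [← mul_add]
          refine mul_le_mul_of_nonneg_left ?_ (hw i)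
          have a := (abs_le.1 (hd i h hh g hg)).1
          have b := hst i h (fs i) g
          rw [hss i (fs i) g] at b
          linarith
        _ = _ := Finset.sum_add_distrib
    have h2 := htt h g ft
    linarith
  linarith
end
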